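/- arXiv:2005.06156 — 4 statements merged into one kernel-verified Lean document; each statement's English description precedes it below -/
import Mathlib

section
/- Let d ≥ 1, T > 0, and let Δ ∈ ℝ^d satisfy π·T·‖Δ‖₂ ≥ d. Then |sinc_T(Δ)| = |∏_{r=1}^d sinc(T·Δ_r)| ≤ 1/(π·T·‖Δ‖₂ − (d − 1)). -/
open Real

/-- `sinc x = sin(π x)/(π x)` for `x ≠ 0`, and `sinc 0 = 1`. -/
noncomputable def sinc (x : ℝ) : ℝ := if x = 0 then 1 else Real.sin (π * x) / (π * x)

/-- Euclidean (`ℓ₂`) norm of a vector in `ℝ^d`. -/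
noncomputable def l2norm {d : ℕ} (x : Fin d → ℝ) : ℝ := Real.sqrt (∑ r, (x r) ^ 2)

lemma abs_sinc_le_inv_max (x : ℝ) : |_root_.sinc x| ≤ (max 1 |π * x|)⁻¹ := by
  unfold _root_.sinc
  split_ifs with hx
  · simp [hx]
  · have hpos : 0 < |π * x| := abs_pos.mpr (mul_ne_zero pi_ne_zero hx)
    rw [abs_div, div_le_iff₀ hpos, ← div_eq_inv_mul, le_div_iff₀ (by positivity)]
    rcases max_cases 1 |π * x| with ⟨hm, -⟩ | ⟨hm, -⟩
    · rw [hm, mul_one]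
      exact abs_sin_le_abs
    · rw [hm]
      exact mul_le_of_le_one_left hpos.le (abs_sin_le_one _)

lemma one_add_sum_sub_one_le_prod {ι : Type*} (s : Finset ι) (m : ι → ℝ)
    (hm : ∀ i ∈ s, 1 ≤ m i) : 1 + ∑ i ∈ s, (m i - 1) ≤ ∏ i ∈ s, m i := by
  classical
  induction s using Finset.induction_on with
  | empty => simp
  | insert a s ha ih =>
    rw [Finset.sum_insert ha, Finset.prod_insert ha]
    have hs : ∀ i ∈ s, 1 ≤ m i := fun i hi ↦ hm i (Finset.mem_insert_of_mem hi)
    have hprod : 1 ≤ ∏ i ∈ s, m i := Finset.one_le_prod hs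
    nlinarith [ih hs, hm a (Finset.mem_insert_self a s)]

lemma l2norm_le_sum_abs {d : ℕ} (x : Fin d → ℝ) : l2norm x ≤ ∑ r, |x r| := by
  refine Real.sqrt_le_iff.mpr ⟨by positivity, ?_⟩
  simpa using Finset.sum_sq_le_sq_sum_of_nonneg (s := Finset.univ) (f := fun r ↦ |x r|)
    fun r _ ↦ abs_nonneg (x r)

theorem stmt_14 (d : ℕ) (hd : 1 ≤ d) (T : ℝ) (hT : 0 < T) (Δ : Fin d → ℝ)
    (h : (d : ℝ) ≤ π * T * l2norm Δ) :
    |∏ r, _root_.sinc (T * Δ r)| ≤ 1 / (π * T * l2norm Δ - ((d : ℝ) - 1)) := by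
  have hnorm : π * T * l2norm Δ ≤ ∑ r, max 1 |π * (T * Δ r)| :=
    calc π * T * l2norm Δ ≤ π * T * ∑ r, |Δ r| := by gcongr; exact l2norm_le_sum_abs Δ
      _ = ∑ r, |π * (T * Δ r)| := by
        simp only [Finset.mul_sum, abs_mul, abs_of_pos pi_pos, abs_of_pos hT, mul_assoc]
      _ ≤ _ := Finset.sum_le_sum fun r _ ↦ le_max_right _ _
  have hprod := one_add_sum_sub_one_le_prod Finset.univ (fun r ↦ max 1 |π * (T * Δ r)|)
    fun r _ ↦ le_max_left _ _
  simp only [Finset.sum_sub_distrib, Finset.sum_const, Finset.card_univ, Fintype.card_fin,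
    nsmul_eq_mul, mul_one] at hprod
  calc |∏ r, _root_.sinc (T * Δ r)| ≤ ∏ r, (max 1 |π * (T * Δ r)|)⁻¹ := by
        rw [Finset.abs_prod]
        exact Finset.prod_le_prod (fun r _ ↦ abs_nonneg _) fun r _ ↦ abs_sinc_le_inv_max _
    _ = 1 / ∏ r, max 1 |π * (T * Δ r)| := by rw [Finset.prod_inv_distrib, one_div]
    _ ≤ _ := one_div_le_one_div_of_le (by linarith) (by linarith)
end

section
/- Let d ≥ 1, T > 0, and let (v, f), (v', f') ∈ ℂ × ℝ^d be tones with error function a(τ) := v·e^{2πi·f^⊤τ} − v'·e^{2πi·f'^⊤τ}. Assume −1/4 ≤ sinc_T(f' − f) ≤ 1. Then T^{-d} · ∫_{[−T/2, T/2]^d} |a(τ)|² dτ ≥ (3/13) · ( |v − v'|² + (|v|² + |v'|²) · (1 − sinc_T(f' − f)) ). -/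
open Real MeasureTheory

/-- `sincT T Δ = ∏_r sinc (T * Δ_r)`. -/
noncomputable def sincT {d : ℕ} (T : ℝ) (Δ : Fin d → ℝ) : ℝ := ∏ r, _root_.sinc (T * Δ r)

/-- The pure tone `τ ↦ v · e^{2πi f·τ}`. -/
noncomputable def tone {d : ℕ} (v : ℂ) (f : Fin d → ℝ) (τ : Fin d → ℝ) : ℂ :=
  v * Complex.exp (2 * (π : ℂ) * Complex.I * ((∑ r, f r * τ r : ℝ) : ℂ))

/-- The box `[-T/2, T/2]^d`. -/
noncomputable def box (d : ℕ) (T : ℝ) : Set (Fin d → ℝ) :=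
  Set.univ.pi fun _ => Set.Icc (-T / 2) (T / 2)

/-- The Fourier integral of a symmetric interval is a rescaled `sinc`. -/
lemma integral_Icc_exp_eq_sinc (T : ℝ) (hT : 0 < T) (δ : ℝ) :
    ∫ x in Set.Icc (-T / 2) (T / 2), Complex.exp (2 * (π : ℂ) * Complex.I * (δ * x : ℝ)) =
      ((T * _root_.sinc (T * δ) : ℝ) : ℂ) := by
  rw [integral_Icc_eq_integral_Ioc, ← intervalIntegral.integral_of_le (by linarith)]
  rcases eq_or_ne δ 0 with rfl | hδ
  · simp only [zero_mul, Complex.ofReal_zero, mul_zero, Complex.exp_zero,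
      intervalIntegral.integral_const, _root_.sinc, if_true, mul_one]
    rw [Complex.real_smul, mul_one]
    congr 1
    ring
  · have hπ : (π : ℂ) ≠ 0 := Complex.ofReal_ne_zero.2 pi_ne_zero
    have hδ' : (δ : ℂ) ≠ 0 := Complex.ofReal_ne_zero.2 hδ
    have hT' : (T : ℂ) ≠ 0 := Complex.ofReal_ne_zero.2 hT.ne'
    have hc : 2 * (π : ℂ) * Complex.I * δ ≠ 0 := by simp [hδ, pi_ne_zero]
    have hexp := integral_exp_mul_complex (a := -T / 2) (b := T / 2) hc
    simp only [Complex.ofReal_mul, ← mul_assoc]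
    rw [hexp, _root_.sinc, if_neg (mul_ne_zero hT.ne' hδ)]
    push_cast
    rw [Complex.sin,
      show 2 * (π : ℂ) * Complex.I * δ * (T / 2) = π * (T * δ) * Complex.I by ring,
      show 2 * (π : ℂ) * Complex.I * δ * (-T / 2) = -(π * (T * δ)) * Complex.I by ring]
    field_simp
    rw [Complex.I_sq]
    ring

/-- The Fourier integral of the box is a rescaled `sincT`. -/
lemma integral_box_exp_eq_sincT {d : ℕ} (T : ℝ) (hT : 0 < T) (Δ : Fin d → ℝ) :
    ∫ τ in box d T, Complex.exp (2 * (π : ℂ) * Complex.I * (∑ r, Δ r * τ r : ℝ)) =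
      ((T ^ d * sincT T Δ : ℝ) : ℂ) := by
  have hprod : ∀ τ : Fin d → ℝ,
      Complex.exp (2 * (π : ℂ) * Complex.I * (∑ r, Δ r * τ r : ℝ)) =
        ∏ r, Complex.exp (2 * (π : ℂ) * Complex.I * (Δ r * τ r : ℝ)) := fun τ => by
    rw [← Complex.exp_sum, Complex.ofReal_sum, Finset.mul_sum]
  simp only [hprod]
  rw [box, volume_pi, Measure.restrict_pi_pi,
    integral_fintype_prod_eq_prod
      (f := fun r x => Complex.exp (2 * (π : ℂ) * Complex.I * (Δ r * x : ℝ)))]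
  simp only [integral_Icc_exp_eq_sinc T hT]
  rw [← Complex.ofReal_prod, Finset.prod_mul_distrib]
  simp [sincT]

/-- The squared distance of two tones at a point, as a constant plus an oscillating term. -/
lemma norm_tone_sub_tone_sq {d : ℕ} (v v' : ℂ) (f f' τ : Fin d → ℝ) :
    ‖tone v f τ - tone v' f' τ‖ ^ 2 = ‖v‖ ^ 2 + ‖v'‖ ^ 2 -
      2 * (starRingEnd ℂ v * v' *
        Complex.exp (2 * (π : ℂ) * Complex.I * (∑ r, (f' - f) r * τ r : ℝ))).re := by
  have hnorm : ∀ (w : ℂ) (g : Fin d → ℝ), ‖tone w g τ‖ = ‖w‖ := fun w g => by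
    rw [tone, norm_mul, Complex.norm_exp]
    simp
  have hcross : starRingEnd ℂ (tone v f τ) * tone v' f' τ = starRingEnd ℂ v * v' *
      Complex.exp (2 * (π : ℂ) * Complex.I * (∑ r, (f' - f) r * τ r : ℝ)) := by
    have hsum : (∑ r, (f' - f) r * τ r) = ∑ r, f' r * τ r - ∑ r, f r * τ r := by
      simp [sub_mul]
    rw [hsum, tone, tone, map_mul, ← Complex.exp_conj]
    simp only [map_mul, Complex.conj_I, Complex.conj_ofReal, Complex.ofReal_sub, map_ofNat]
    rw [mul_mul_mul_comm, ← Complex.exp_add]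
    ring_nf
  rw [← hcross, ← hnorm v f, ← hnorm v' f']
  simp only [← Complex.normSq_eq_norm_sq, Complex.normSq_apply, Complex.sub_re, Complex.sub_im,
    Complex.mul_re, Complex.conj_re, Complex.conj_im]
  ring

/-- The mean squared distance of two tones over the box. -/
lemma mean_norm_tone_sub_tone_sq {d : ℕ} (T : ℝ) (hT : 0 < T) (v v' : ℂ) (f f' : Fin d → ℝ) :
    (T ^ d)⁻¹ * ∫ τ in box d T, ‖tone v f τ - tone v' f' τ‖ ^ 2 =
      ‖v‖ ^ 2 + ‖v'‖ ^ 2 - 2 * sincT T (f' - f) * (starRingEnd ℂ v * v').re := by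
  have hcompact : IsCompact (box d T) := isCompact_univ_pi fun _ => isCompact_Icc
  have hint : IntegrableOn (fun τ : Fin d → ℝ => starRingEnd ℂ v * v' *
      Complex.exp (2 * (π : ℂ) * Complex.I * (∑ r, (f' - f) r * τ r : ℝ))) (box d T) :=
    ContinuousOn.integrableOn_compact hcompact (by fun_prop)
  have hvol : volume.real (box d T) = T ^ d := by
    rw [measureReal_def, box, volume_pi_pi]
    simp [Real.volume_Icc, ← ENNReal.ofReal_pow, show T / 2 - -T / 2 = T by ring, hT.le]
  have hconst : IntegrableOn (fun _ => ‖v‖ ^ 2 + ‖v'‖ ^ 2) (box d T) :=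
    continuousOn_const.integrableOn_compact hcompact
  have hre := integral_re hint
  have hreint := hint.re.const_mul 2
  simp only [RCLike.re_to_complex] at hre hreint
  simp only [norm_tone_sub_tone_sq]
  rw [integral_sub hconst hreint,
    integral_const_mul, setIntegral_const, hvol]
  rw [hre, integral_const_mul, integral_box_exp_eq_sincT T hT, Complex.re_mul_ofReal, smul_eq_mul]
  have hTd : T ^ d ≠ 0 := (pow_pos hT d).ne'
  field_simp

theorem stmt_15 (d : ℕ) (hd : 1 ≤ d) (T : ℝ) (hT : 0 < T)
    (v v' : ℂ) (f f' : Fin d → ℝ)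
    (h1 : -(1 / 4) ≤ sincT T (f' - f)) (h2 : sincT T (f' - f) ≤ 1) :
    (3 / 13) * (‖v - v'‖ ^ 2 +
        (‖v‖ ^ 2 + ‖v'‖ ^ 2) * (1 - sincT T (f' - f))) ≤
      (T ^ d)⁻¹ * ∫ τ in box d T, ‖tone v f τ - tone v' f' τ‖ ^ 2 := by
  rw [mean_norm_tone_sub_tone_sq T hT]
  generalize sincT T (f' - f) = s at h1 h2
  simp only [← Complex.normSq_eq_norm_sq, Complex.normSq_apply, Complex.sub_re, Complex.sub_im,
    Complex.mul_re, Complex.conj_re, Complex.conj_im]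
  have hminus : 0 ≤ (1 - s) * ((v.re + v'.re) ^ 2 + (v.im + v'.im) ^ 2) :=
    mul_nonneg (by linarith) (by positivity)
  have hplus : 0 ≤ (s + 1 / 4) * ((v.re - v'.re) ^ 2 + (v.im - v'.im) ^ 2) :=
    mul_nonneg (by linarith) (by positivity)
  linarith
end

section
/- There exist universal constants C₀, C₁ > 0 with the following property. Let d ≥ 1, T > 0, and let (v_i, f_i), (v_i', f_i'), (v_j, f_j), (v_j', f_j') ∈ ℂ × ℝ^d be tones with error functions a_i(τ) := v_i·e^{2πi·f_i^⊤τ} − v_i'·e^{2πi·f_i'^⊤τ} and a_j(τ) := v_j·e^{2πi·f_j^⊤τ} − v_j'·e^{2πi·f_j'^⊤τ}. Set Δf := min{ ‖g − g'‖₂ : g ∈ {f_i, f_i'}, g' ∈ {f_j, f_j'} } and assume Δf > 0, ‖f_i − f_i'‖₂ ≤ Δf, ‖f_j − f_j'‖₂ ≤ Δf, and T ≥ C₀·d/Δf. Then | T^{-d} · ∫_{[−T/2, T/2]^d} ( a_i(τ)·conj(a_j(τ)) + conj(a_i(τ))·a_j(τ) ) dτ | ≤ C₁ · (√d / (Δf·T))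 · ‖a_i‖_T · ‖a_j‖_T. -/
open Real MeasureTheory

/-- `‖a‖_T := sqrt( T^{-d} ∫_{[-T/2,T/2]^d} |a(τ)|² dτ )`. -/
noncomputable def errT {d : ℕ} (T : ℝ) (a : (Fin d → ℝ) → ℂ) : ℝ :=
  Real.sqrt ((T ^ d)⁻¹ * ∫ τ in box d T, norm (a τ) ^ 2)

theorem continuous_tone {d : ℕ} (v : ℂ) (f : Fin d → ℝ) : Continuous (tone v f) := by
  unfold tone
  fun_prop

theorem integrable_box {d : ℕ} {E : Type*} [NormedAddCommGroup E] {F : (Fin d → ℝ) → E}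
    (hF : Continuous F) (T : ℝ) : IntegrableOn F (box d T) :=
  hF.continuousOn.integrableOn_compact (isCompact_univ_pi fun _ => isCompact_Icc)

theorem integral_box_eq {n : ℕ} {E : Type*} [NormedAddCommGroup E] [NormedSpace ℝ E]
    (m : Fin (n + 1)) (T : ℝ) {F : (Fin (n + 1) → ℝ) → E} (hF : Continuous F) :
    Integrable (fun y => ∫ t in Set.Icc (-T / 2) (T / 2), F (m.insertNth t y))
        (volume.restrict (box n T)) ∧
      ∫ τ in box (n + 1) T, F τ =
      ∫ y in box n T, ∫ t in Set.Icc (-T / 2) (T / 2), F (m.insertNth t y) := by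
  have hbox (k : ℕ) : volume.restrict (box k T) =
      Measure.pi fun _ : Fin k => volume.restrict (Set.Icc (-T / 2) (T / 2)) :=
    Measure.restrict_pi_pi _ _
  have hmp := (measurePreserving_piFinSuccAbove
    (fun _ : Fin (n + 1) => (volume : Measure ℝ).restrict (Set.Icc (-T / 2) (T / 2))) m).symm
  have hint := integrable_box hF T
  rw [IntegrableOn, hbox] at hint
  have hint' := (hmp.integrable_comp_emb (MeasurableEquiv.measurableEmbedding _)).2 hint
  rw [hbox, hbox, ← hmp.integral_comp (MeasurableEquiv.measurableEmbedding _)]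
  exact ⟨hint'.integral_prod_right, integral_prod_symm _ hint'⟩

theorem norm_integral_box_le {n : ℕ} (m : Fin (n + 1)) (T : ℝ)
    {F : (Fin (n + 1) → ℝ) → ℂ} {G : (Fin (n + 1) → ℝ) → ℝ}
    (hF : Continuous F) (hG : Continuous G)
    (h : ∀ y, ‖∫ t in Set.Icc (-T / 2) (T / 2), F (m.insertNth t y)‖ ≤
      ∫ t in Set.Icc (-T / 2) (T / 2), G (m.insertNth t y)) :
    ‖∫ τ in box (n + 1) T, F τ‖ ≤ ∫ τ in box (n + 1) T, G τ := by
  rw [(integral_box_eq m T hF).2, (integral_box_eq m T hG).2]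
  exact norm_integral_le_of_norm_le (integral_box_eq m T hG).1 (.of_forall h)

theorem tone_insertNth {n : ℕ} (m : Fin (n + 1)) (v : ℂ) (f : Fin (n + 1) → ℝ) (t : ℝ)
    (y : Fin n → ℝ) :
    tone v f (m.insertNth t y) =
      tone v (fun j => f (m.succAbove j)) y * Complex.exp (2 * π * Complex.I * f m * t) := by
  unfold tone
  rw [mul_assoc v, ← Complex.exp_add, Fin.sum_univ_succAbove _ m]
  congr 2
  simp
  ring

theorem norm_tone {d : ℕ} (v : ℂ) (f τ : Fin d → ℝ) : ‖tone v f τ‖ = ‖v‖ := by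
  unfold tone
  rw [norm_mul, show 2 * (π : ℂ) * Complex.I * ((∑ r, f r * τ r : ℝ) : ℂ) =
    ((2 * π * ∑ r, f r * τ r : ℝ) : ℂ) * Complex.I by push_cast; ring,
    Complex.norm_exp_ofReal_mul_I, mul_one]

theorem hasDerivAt_exp_phase (g t : ℝ) :
    HasDerivAt (fun t : ℝ => Complex.exp (2 * π * Complex.I * g * t))
      (2 * π * Complex.I * g * Complex.exp (2 * π * Complex.I * g * t)) t := by
  have h1 : HasDerivAt (fun t : ℝ => 2 * π * Complex.I * g * (t : ℂ)) (2 * π * Complex.I * g) t := by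
    simpa using (Complex.ofRealCLM.hasDerivAt (x := t)).const_mul (2 * π * Complex.I * g)
  simpa [mul_comm] using h1.cexp

theorem norm_exp_phase (g t : ℝ) : ‖Complex.exp (2 * π * Complex.I * g * t)‖ = 1 := by
  rw [show 2 * (π : ℂ) * Complex.I * g * t = ((2 * π * g * t : ℝ) : ℂ) * Complex.I by
    push_cast; ring, Complex.norm_exp_ofReal_mul_I]

theorem norm_le_average_add {a b x : ℝ} (hab : a < b) (hx : x ∈ Set.Icc a b) {φ φ' : ℝ → ℂ}
    (hφ : ∀ t, HasDerivAt φ (φ' t) t) (hφ' : Continuous φ') :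
    ‖φ x‖ ≤ (b - a)⁻¹ * (∫ t in a..b, ‖φ t‖) + ∫ t in a..b, ‖φ' t‖ := by
  have hc : Continuous φ := continuous_iff_continuousAt.2 fun t => (hφ t).continuousAt
  have key : ∀ t ∈ Set.Icc a b, ‖φ x‖ - (∫ t in a..b, ‖φ' t‖) ≤ ‖φ t‖ := by
    intro t ht
    have h1 := intervalIntegral.integral_eq_sub_of_hasDerivAt (fun s _ => hφ s)
      (hφ'.intervalIntegrable t x)
    have h2 := intervalIntegral.norm_integral_le_abs_integral_norm (f := φ') (a := t) (b := x)
      (μ := volume)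
    have h3 : |∫ s in t..x, ‖φ' s‖| ≤ |∫ s in a..b, ‖φ' s‖| := by
      refine intervalIntegral.abs_integral_mono_interval ?_ (.of_forall fun s => norm_nonneg _)
        (hφ'.norm.intervalIntegrable _ _)
      rw [Set.uIoc_of_le hab.le]
      intro s hs
      rw [Set.mem_uIoc] at hs
      rcases hs with hs | hs
      · exact ⟨ht.1.trans_lt hs.1, hs.2.trans hx.2⟩
      · exact ⟨hx.1.trans_lt hs.1, hs.2.trans ht.2⟩
    rw [abs_of_nonneg (intervalIntegral.integral_nonneg hab.le fun _ _ => norm_nonneg _)] at h3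
    rw [h1] at h2
    have := norm_sub_norm_le (φ x) (φ t)
    linarith
  have h4 := intervalIntegral.integral_mono_on hab.le
    (intervalIntegrable_const (μ := volume)) (hc.norm.intervalIntegrable a b) key
  rw [intervalIntegral.integral_const, smul_eq_mul] at h4
  have : ‖φ x‖ - (∫ t in a..b, ‖φ' t‖) ≤ (b - a)⁻¹ * (∫ t in a..b, ‖φ t‖) := by
    rw [inv_mul_eq_div, le_div_iff₀ (by linarith)]
    linarith
  linarith

theorem norm_integral_exp_phase_mul_le {a b g : ℝ} (hab : a < b) (hg : g ≠ 0) {φ φ' : ℝ → ℂ}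
    (hφ : ∀ t, HasDerivAt φ (φ' t) t) (hφ' : Continuous φ') :
    ‖∫ t in a..b, Complex.exp (2 * π * Complex.I * g * t) * φ t‖ ≤
      ∫ t in a..b, (2 * π * |g|)⁻¹ * (2 * (b - a)⁻¹ * ‖φ t‖ + 3 * ‖φ' t‖) := by
  have hc : Continuous φ := continuous_iff_continuousAt.2 fun t => (hφ t).continuousAt
  have hnorm : ‖2 * (π : ℂ) * Complex.I * g‖ = 2 * π * |g| := by
    simp [abs_of_pos Real.pi_pos]
  have hp : 0 < 2 * π * |g| := by positivity
  have hibp := intervalIntegral.integral_mul_deriv_eq_deriv_mul (a := a) (b := b)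
    (fun t _ => hφ t) (fun t _ => hasDerivAt_exp_phase g t)
    (hφ'.intervalIntegrable a b)
    (Continuous.intervalIntegrable (by fun_prop) a b)
  have hpull : (∫ t in a..b, φ t * (2 * π * Complex.I * g *
      Complex.exp (2 * π * Complex.I * g * t))) =
      (2 * π * Complex.I * g) * ∫ t in a..b, Complex.exp (2 * π * Complex.I * g * t) * φ t := by
    rw [← intervalIntegral.integral_const_mul]
    congr 1 with t
    ring
  have hrem : ‖∫ t in a..b, φ' t * Complex.exp (2 * π * Complex.I * g * t)‖ ≤
      ∫ t in a..b, ‖φ' t‖ := by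
    refine (intervalIntegral.norm_integral_le_integral_norm hab.le).trans_eq ?_
    simp [norm_exp_phase]
  have hb := norm_le_average_add hab (Set.right_mem_Icc.2 hab.le) hφ hφ'
  have ha := norm_le_average_add hab (Set.left_mem_Icc.2 hab.le) hφ hφ'
  rw [hpull] at hibp
  have hn := congrArg norm hibp
  rw [norm_mul, hnorm] at hn
  have htri := norm_sub_le_of_le (norm_sub_le_of_le (a₁ := φ b * Complex.exp (2 * π * Complex.I * g * b))
    (a₂ := φ a * Complex.exp (2 * π * Complex.I * g * a)) (r₁ := ‖φ b‖) (r₂ := ‖φ a‖)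
    (by rw [norm_mul, norm_exp_phase, mul_one]) (by rw [norm_mul, norm_exp_phase, mul_one])) hrem
  rw [intervalIntegral.integral_const_mul, intervalIntegral.integral_add
    (Continuous.intervalIntegrable (by fun_prop) a b)
    (Continuous.intervalIntegrable (by fun_prop) a b), intervalIntegral.integral_const_mul,
    intervalIntegral.integral_const_mul, inv_mul_eq_div, le_div_iff₀ hp]
  linarith

theorem norm_integral_tone_mul_le {n : ℕ} (m : Fin (n + 1)) {T : ℝ} (hT : 0 < T)
    (g δ δ' : Fin (n + 1) → ℝ) (A B A' B' : ℂ) (hg : g m ≠ 0) :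
    ‖∫ τ in box (n + 1) T, tone 1 g τ * ((A + tone B δ τ) *
        (starRingEnd ℂ) (A' + tone B' δ' τ))‖ ≤
      ∫ τ in box (n + 1) T, (2 * π * |g m|)⁻¹ * (2 * T⁻¹ * (‖A + tone B δ τ‖ * ‖A' + tone B' δ' τ‖) +
        3 * (2 * π * |δ m| * ‖B‖ * ‖A' + tone B' δ' τ‖ +
          ‖A + tone B δ τ‖ * (2 * π * |δ' m| * ‖B'‖))) := by
  have := continuous_tone 1 g
  have := continuous_tone B δ
  have := continuous_tone B' δ'
  refine norm_integral_box_le m T (by fun_prop) (by fun_prop) fun y => ?_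
  have hlt : -T / 2 < T / 2 := by linarith
  rw [integral_Icc_eq_integral_Ioc, ← intervalIntegral.integral_of_le hlt.le,
    integral_Icc_eq_integral_Ioc, ← intervalIntegral.integral_of_le hlt.le]
  simp only [tone_insertNth]
  set c := tone 1 (fun j => g (m.succAbove j)) y
  have hcn : ‖c‖ = 1 := by simp [c, norm_tone]
  set b := tone B (fun j => δ (m.succAbove j)) y
  have hbn : ‖b‖ = ‖B‖ := norm_tone _ _ _
  set b' := tone B' (fun j => δ' (m.succAbove j)) y
  have hbn' : ‖b'‖ = ‖B'‖ := norm_tone _ _ _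
  have hd (A b : ℂ) (δ t : ℝ) :
      HasDerivAt (fun t : ℝ => A + b * Complex.exp (2 * π * Complex.I * δ * t))
        (b * (2 * π * Complex.I * δ * Complex.exp (2 * π * Complex.I * δ * t))) t :=
    ((hasDerivAt_exp_phase δ t).const_mul b).const_add A
  have hφ (t : ℝ) := (hd A b (δ m) t).mul (hd A' b' (δ' m) t).star
  have h := norm_integral_exp_phase_mul_le hlt hg hφ (by fun_prop)
  have e : ∀ t : ℝ, c * Complex.exp (2 * π * Complex.I * g m * t) *
      ((A + b * Complex.exp (2 * π * Complex.I * δ m * t)) *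
        (starRingEnd ℂ) (A' + b' * Complex.exp (2 * π * Complex.I * δ' m * t))) =
      c * (Complex.exp (2 * π * Complex.I * g m * t) *
      ((A + b * Complex.exp (2 * π * Complex.I * δ m * t)) *
        star (A' + b' * Complex.exp (2 * π * Complex.I * δ' m * t)))) := fun t => by
    rw [mul_assoc]; rfl
  simp only [e]
  rw [intervalIntegral.integral_const_mul, norm_mul, hcn, one_mul]
  refine h.trans (intervalIntegral.integral_mono_on hlt.le
    (Continuous.intervalIntegrable (by fun_prop) _ _)
    (Continuous.intervalIntegrable (by fun_prop) _ _) fun t _ => ?_)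
  have hnd (b : ℂ) (δ t : ℝ) :
      ‖b * (2 * π * Complex.I * δ * Complex.exp (2 * π * Complex.I * δ * t))‖ =
        2 * π * |δ| * ‖b‖ := by
    rw [norm_mul, norm_mul, norm_exp_phase]
    simp [abs_of_pos Real.pi_pos]
    ring
  refine mul_le_mul_of_nonneg_left ?_ (by positivity)
  refine add_le_add (le_of_eq ?_) (mul_le_mul_of_nonneg_left ?_ (by norm_num))
  · rw [Pi.mul_apply, norm_mul, norm_star]
    congr 3
    ring
  · refine norm_add_le_of_le ?_ ?_
    · rw [norm_mul, hnd, norm_star, hbn]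
    · rw [norm_mul, norm_star, hnd, hbn']

theorem integral_box_one (d : ℕ) {T : ℝ} (hT : 0 < T) : ∫ _ in box d T, (1 : ℝ) = T ^ d := by
  have : volume (box d T) = ENNReal.ofReal T ^ d := by
    rw [box, volume_pi_pi]
    simp [show T / 2 - -T / 2 = T by ring]
  simp [Measure.real, this, hT.le]

theorem errT_sq {d : ℕ} {T : ℝ} (hT : 0 < T) (a : (Fin d → ℝ) → ℂ) :
    errT T a ^ 2 = (T ^ d)⁻¹ * ∫ τ in box d T, ‖a τ‖ ^ 2 :=
  Real.sq_sqrt (mul_nonneg (by positivity) (integral_nonneg fun _ => by positivity))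

theorem errT_nonneg {d : ℕ} (T : ℝ) (a : (Fin d → ℝ) → ℂ) : 0 ≤ errT T a := Real.sqrt_nonneg _

theorem errT_congr_norm {d : ℕ} (T : ℝ) {a b : (Fin d → ℝ) → ℂ} (h : ∀ τ, ‖a τ‖ = ‖b τ‖) :
    errT T a = errT T b := by
  simp only [errT, h]

theorem errT_const {d : ℕ} {T : ℝ} (hT : 0 < T) (c : ℂ) :
    errT T (fun _ : Fin d → ℝ => c) = ‖c‖ := by
  have h := integral_box_one d hT
  rw [← sq_eq_sq₀ (errT_nonneg _ _) (norm_nonneg _), errT_sq hT, ← mul_one (‖c‖ ^ 2),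
    integral_const_mul, h]
  field_simp

theorem integral_norm_mul_norm_le {d : ℕ} {T : ℝ} (hT : 0 < T) {a b : (Fin d → ℝ) → ℂ}
    (ha : Continuous a) (hb : Continuous b) :
    (T ^ d)⁻¹ * ∫ τ in box d T, ‖a τ‖ * ‖b τ‖ ≤ errT T a * errT T b := by
  have hmem {a : (Fin d → ℝ) → ℂ} (ha : Continuous a) :
      MemLp (fun τ => ‖a τ‖) (ENNReal.ofReal 2) (volume.restrict (box d T)) := by
    rw [ENNReal.ofReal_ofNat, memLp_two_iff_integrable_sq ha.norm.aestronglyMeasurable]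
    exact integrable_box (by fun_prop) T
  have h := integral_mul_le_Lp_mul_Lq_of_nonneg (p := 2) (q := 2)
    Real.HolderConjugate.two_two
    (.of_forall fun τ => norm_nonneg (a τ)) (.of_forall fun τ => norm_nonneg (b τ))
    (hmem ha) (hmem hb)
  simp only [Real.rpow_two, ← Real.sqrt_eq_rpow] at h
  rw [errT, errT, Real.sqrt_mul (by positivity), Real.sqrt_mul (by positivity),
    mul_mul_mul_comm, Real.mul_self_sqrt (by positivity)]
  exact mul_le_mul_of_nonneg_left h (by positivity)

theorem integral_norm_le_errT {d : ℕ} {T : ℝ} (hT : 0 < T) {a : (Fin d → ℝ) → ℂ}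
    (ha : Continuous a) : (T ^ d)⁻¹ * ∫ τ in box d T, ‖a τ‖ ≤ errT T a := by
  have h := integral_norm_mul_norm_le hT ha (continuous_const (y := (1 : ℂ)))
  rw [errT_const hT] at h
  simpa using h

theorem sin_sq_mul_le (y : ℝ) : sin y ^ 2 * (1 + y ^ 2 / 4) ≤ y ^ 2 := by
  rcases le_or_gt (y ^ 2) 4 with hy | hy
  · have hy2 : |y / 2| ≤ 1 := abs_le_one_iff_mul_self_le_one.2 (by nlinarith)
    obtain ⟨hl, hr⟩ := abs_le.1 hy2
    have hpi := Real.pi_gt_three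
    have hcos := Real.cos_le_one_div_sqrt_sq_add_one (x := y / 2) (by linarith) (by linarith)
    have hcos0 : 0 ≤ cos (y / 2) :=
      Real.cos_nonneg_of_neg_pi_div_two_le_of_le (by linarith) (by linarith)
    have hsq : cos (y / 2) ^ 2 ≤ 1 / ((y / 2) ^ 2 + 1) := by
      refine (pow_le_pow_left₀ hcos0 hcos 2).trans_eq ?_
      rw [div_pow, one_pow, Real.sq_sqrt (by positivity)]
    rw [le_div_iff₀ (by positivity)] at hsq
    have hsin : sin (y / 2) ^ 2 ≤ (y / 2) ^ 2 := sq_le_sq.2 Real.abs_sin_le_abs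
    have hdouble : sin y = 2 * sin (y / 2) * cos (y / 2) := by
      rw [← Real.sin_two_mul]
      congr 1
      ring
    calc sin y ^ 2 * (1 + y ^ 2 / 4)
        = 4 * sin (y / 2) ^ 2 * (cos (y / 2) ^ 2 * ((y / 2) ^ 2 + 1)) := by rw [hdouble]; ring
      _ ≤ 4 * (y / 2) ^ 2 * 1 := by gcongr
      _ = y ^ 2 := by ring
  · nlinarith [Real.sin_sq_le_one y]

theorem abs_sin_pi_mul_le (x : ℝ) : |sin (π * x)| ≤ |π * x| * (1 - min 1 (x ^ 2) / 4) := by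
  have h := sin_sq_mul_le (π * x)
  have hpi := Real.pi_gt_three
  have h1 : min 1 (x ^ 2) ≤ 1 := min_le_left _ _
  have h2 : min 1 (x ^ 2) ≤ x ^ 2 := min_le_right _ _
  have h0 : 0 ≤ min 1 (x ^ 2) := le_min zero_le_one (sq_nonneg x)
  set k := min 1 (x ^ 2)
  set y := π * x with hy
  have hyx : 9 * x ^ 2 ≤ y ^ 2 := by 
    rw [hy, mul_pow]
    exact mul_le_mul_of_nonneg_right (by nlinarith) (sq_nonneg x)
  have hfac : 1 ≤ (1 - k / 4) ^ 2 * (1 + y ^ 2 / 4) := by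
    have : k * y ^ 2 ≤ y ^ 2 := mul_le_of_le_one_left (sq_nonneg y) h1
    nlinarith [sq_nonneg (k * y)]
  refine abs_le_of_sq_le_sq ?_ ?_
  · rw [mul_pow, sq_abs]
    have hp : 0 < 1 + y ^ 2 / 4 := by positivity
    refine le_of_mul_le_mul_right (h.trans ?_) hp
    rw [mul_assoc]
    exact le_mul_of_one_le_right (sq_nonneg y) hfac
  · exact mul_nonneg (abs_nonneg _) (by linarith)

theorem norm_integral_exp_phase_le {T : ℝ} (hT : 0 < T) (δ : ℝ) :
    ‖∫ t in (-T / 2)..(T / 2), Complex.exp (2 * π * Complex.I * δ * t)‖ ≤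
      T * (1 - min 1 ((T * δ) ^ 2) / 4) := by
  rcases eq_or_ne δ 0 with rfl | hδ
  · simp [show T / 2 - -T / 2 = T by ring, abs_of_pos hT]
  have hne : 2 * (π : ℂ) * Complex.I * δ ≠ 0 := by simp [hδ, Real.pi_ne_zero]
  have hval : ∫ t in (-T / 2)..(T / 2), Complex.exp (2 * π * Complex.I * δ * t) =
      ((sin (π * (T * δ)) / (π * δ) : ℝ) : ℂ) := by
    rw [integral_exp_mul_complex hne]
    push_cast
    rw [Complex.sin]
    have hδ' : (δ : ℂ) ≠ 0 := by exact_mod_cast hδ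
    have hπ' : (π : ℂ) ≠ 0 := by exact_mod_cast Real.pi_ne_zero
    rw [show 2 * (π : ℂ) * Complex.I * δ * (T / 2) = π * (T * δ) * Complex.I by ring,
      show 2 * (π : ℂ) * Complex.I * δ * (-T / 2) = -(π * (T * δ)) * Complex.I by ring]
    field_simp
    rw [Complex.I_sq]
    ring
  rw [hval, Complex.norm_real, Real.norm_eq_abs, abs_div, div_le_iff₀ (by positivity)]
  refine (abs_sin_pi_mul_le (T * δ)).trans_eq ?_
  rw [abs_mul, abs_mul, abs_mul, abs_of_pos hT]
  ring

theorem le_integral_norm_sub_sq {T : ℝ} (hT : 0 < T) (p q : ℂ) (f f' : ℝ) :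
    T * (min 1 ((T * (f - f')) ^ 2) / 4 * (‖p‖ ^ 2 + ‖q‖ ^ 2)) ≤
      ∫ t in (-T / 2)..(T / 2), ‖p * Complex.exp (2 * π * Complex.I * f * t) -
        q * Complex.exp (2 * π * Complex.I * f' * t)‖ ^ 2 := by
  have hpt (t : ℝ) : ‖p * Complex.exp (2 * π * Complex.I * f * t) -
        q * Complex.exp (2 * π * Complex.I * f' * t)‖ ^ 2 = (‖p‖ ^ 2 + ‖q‖ ^ 2) -
      2 * (p * (starRingEnd ℂ) q *
        Complex.exp (2 * π * Complex.I * (f - f' : ℝ) * t)).re := by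
    have hconj : (starRingEnd ℂ) (Complex.exp (2 * π * Complex.I * f' * t)) =
        Complex.exp (-(2 * π * Complex.I * f' * t)) := by
      rw [← Complex.exp_conj]
      simp [Complex.conj_ofNat]
    rw [← Complex.normSq_eq_norm_sq, Complex.normSq_sub, Complex.normSq_eq_norm_sq,
      Complex.normSq_eq_norm_sq, norm_mul, norm_mul, norm_exp_phase, norm_exp_phase,
      mul_one, mul_one, map_mul, hconj, mul_mul_mul_comm, ← Complex.exp_add]
    congr 5
    push_cast
    ring_nf
  have hint : ∫ t in (-T / 2)..(T / 2), (p * (starRingEnd ℂ) q *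
        Complex.exp (2 * π * Complex.I * (f - f' : ℝ) * t)).re =
      (p * (starRingEnd ℂ) q * ∫ t in (-T / 2)..(T / 2),
        Complex.exp (2 * π * Complex.I * (f - f' : ℝ) * t)).re := by
    rw [← intervalIntegral.integral_const_mul]
    refine Complex.reCLM.intervalIntegral_comp_comm (f := fun t : ℝ => p * (starRingEnd ℂ) q *
        Complex.exp (2 * π * Complex.I * (f - f' : ℝ) * t)) ?_
    exact Continuous.intervalIntegrable (by fun_prop) _ _
  simp only [hpt]
  rw [intervalIntegral.integral_sub (by simp)
    (Continuous.intervalIntegrable (by fun_prop) _ _), intervalIntegral.integral_const_mul, hint,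
    intervalIntegral.integral_const, smul_eq_mul, show T / 2 - -T / 2 = T by ring]
  have hJ := norm_integral_exp_phase_le hT (f - f')
  set J := ∫ t in (-T / 2)..(T / 2), Complex.exp (2 * π * Complex.I * (f - f' : ℝ) * t)
  have hre := Complex.re_le_norm (p * (starRingEnd ℂ) q * J)
  rw [norm_mul, norm_mul, RCLike.norm_conj] at hre
  have h1 := mul_le_mul_of_nonneg_left hJ (by positivity : 0 ≤ ‖p‖ * ‖q‖)
  have h2 : 2 * (‖p‖ * ‖q‖) ≤ ‖p‖ ^ 2 + ‖q‖ ^ 2 := by nlinarith [sq_nonneg (‖p‖ - ‖q‖)]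
  have h3 := mul_le_mul_of_nonneg_right h2 ((norm_nonneg J).trans hJ)
  linarith

theorem le_errT_sub_sq {d : ℕ} (m : Fin d) {T : ℝ} (hT : 0 < T) (v v' : ℂ) (f f' : Fin d → ℝ) :
    min 1 ((T * (f m - f' m)) ^ 2) / 4 * (‖v‖ ^ 2 + ‖v'‖ ^ 2) ≤
      errT T (fun τ => tone v f τ - tone v' f' τ) ^ 2 := by
  obtain ⟨n, rfl⟩ : ∃ n, d = n + 1 := Nat.exists_eq_succ_of_ne_zero m.pos.ne'
  have := continuous_tone v f
  have := continuous_tone v' f'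
  set c := min 1 ((T * (f m - f' m)) ^ 2) / 4 * (‖v‖ ^ 2 + ‖v'‖ ^ 2) with hc
  have hc0 : 0 ≤ c := by positivity
  have h := norm_integral_box_le m T (F := fun _ => (c : ℂ))
    (G := fun τ => ‖tone v f τ - tone v' f' τ‖ ^ 2) continuous_const (by fun_prop) fun y => by
      have h := le_integral_norm_sub_sq hT (tone v (fun j => f (m.succAbove j)) y)
        (tone v' (fun j => f' (m.succAbove j)) y) (f m) (f' m)
      rw [norm_tone, norm_tone, ← hc, intervalIntegral.integral_of_le (by linarith),
        ← integral_Icc_eq_integral_Ioc] at h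
      simp only [tone_insertNth]
      refine le_of_eq_of_le ?_ h
      simp [Measure.real, abs_of_nonneg hc0, show T / 2 - -T / 2 = T by ring, hT.le]
  rw [errT_sq hT, inv_mul_eq_div, le_div_iff₀ (by positivity)]
  refine le_of_eq_of_le ?_ h
  have hone := integral_box_one (n + 1) hT
  rw [integral_const, smul_eq_mul, mul_one] at hone
  rw [integral_const, hone, norm_smul, Complex.norm_real, Real.norm_of_nonneg hc0,
    Real.norm_of_nonneg (by positivity), mul_comm]

/-- `p` is `e^{2πi f·τ}` times a slowly varying amplitude `A + B e^{2πi δ·τ}`, of size and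
variation across the box at most `E`. -/
def IsModulatedTone {d : ℕ} (T E : ℝ) (f : Fin d → ℝ) (p : (Fin d → ℝ) → ℂ) : Prop :=
  ∃ (A B : ℂ) (δ : Fin d → ℝ), (p = fun τ => tone 1 f τ * (A + tone B δ τ)) ∧
    errT T p ≤ E ∧ ∀ m, T * |δ m| * ‖B‖ ≤ E

theorem IsModulatedTone.continuous {d : ℕ} {T E : ℝ} {f : Fin d → ℝ} {p : (Fin d → ℝ) → ℂ}
    (hp : IsModulatedTone T E f p) : Continuous p := by
  obtain ⟨A, B, δ, rfl, -⟩ := hp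
  exact (continuous_tone 1 f).mul (continuous_const.add (continuous_tone B δ))

theorem tone_eq_mul {d : ℕ} (v : ℂ) (f τ : Fin d → ℝ) : tone v f τ = tone 1 f τ * v := by
  simp [tone, mul_comm]

theorem tone_zero_left {d : ℕ} (f τ : Fin d → ℝ) : tone 0 f τ = 0 := by
  simp [tone]

theorem tone_one_mul_tone {d : ℕ} (v : ℂ) (f g τ : Fin d → ℝ) :
    tone 1 f τ * tone v g τ = tone v (f + g) τ := by
  unfold tone
  rw [one_mul, mul_left_comm, ← Complex.exp_add]
  simp only [Pi.add_apply, add_mul, Finset.sum_add_distrib]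
  push_cast
  ring_nf

theorem conj_tone_one {d : ℕ} (f τ : Fin d → ℝ) :
    (starRingEnd ℂ) (tone 1 f τ) = tone 1 (-f) τ := by
  unfold tone
  rw [one_mul, one_mul, ← Complex.exp_conj]
  simp [Complex.conj_ofNat]

theorem isModulatedTone_tone {d : ℕ} {T E : ℝ} (hT : 0 < T) {v : ℂ} (f : Fin d → ℝ)
    (hv : ‖v‖ ≤ E) : IsModulatedTone T E f (tone v f) := by
  refine ⟨v, 0, 0, ?_, ?_, ?_⟩
  · funext τ
    rw [tone_zero_left, add_zero, tone_eq_mul]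
  · rwa [errT_congr_norm T (b := fun _ => v) fun τ => norm_tone v f τ, errT_const hT]
  · simpa using fun _ => (norm_nonneg v).trans hv

theorem exists_isModulatedTone_add {d : ℕ} {T : ℝ} (hT : 0 < T) (v v' : ℂ) (f f' : Fin d → ℝ) :
    ∃ p q : (Fin d → ℝ) → ℂ,
      (∀ τ, tone v f τ - tone v' f' τ = p τ + q τ) ∧
      IsModulatedTone T (2 * errT T fun τ => tone v f τ - tone v' f' τ) f p ∧
      IsModulatedTone T (2 * errT T fun τ => tone v f τ - tone v' f' τ) f' q := by
  have hlow (m : Fin d) := le_errT_sub_sq m hT v v' f f'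
  have hE := errT_nonneg T fun τ => tone v f τ - tone v' f' τ
  set E := errT T fun τ => tone v f τ - tone v' f' τ with hEdef
  by_cases hfar : ∃ m, 1 ≤ (T * (f m - f' m)) ^ 2
  · obtain ⟨m, hm⟩ := hfar
    have h := hlow m
    rw [min_eq_left hm] at h
    refine ⟨tone v f, tone (-v') f', fun τ => ?_, isModulatedTone_tone hT f ?_,
      isModulatedTone_tone hT f' ?_⟩
    · simp [tone, sub_eq_add_neg]
    · refine (sq_le_sq₀ (by positivity) (by positivity)).1 ?_
      nlinarith [sq_nonneg ‖v'‖]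
    · rw [norm_neg]
      refine (sq_le_sq₀ (by positivity) (by positivity)).1 ?_
      nlinarith [sq_nonneg ‖v‖]
  · push Not at hfar
    refine ⟨fun τ => tone v f τ - tone v' f' τ, tone 0 f', fun τ => ?_,
      ⟨v, -v', f' - f, ?_, by linarith, fun m => ?_⟩, isModulatedTone_tone hT f' (by simpa)⟩
    · rw [tone_zero_left, add_zero]
    · funext τ
      rw [mul_add, ← tone_eq_mul, tone_one_mul_tone, add_sub_cancel]
      simp [tone, sub_eq_add_neg]
    · have h := hlow m
      rw [min_eq_right (hfar m).le] at h
      refine (sq_le_sq₀ (by positivity) (by positivity)).1 ?_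
      rw [norm_neg, mul_pow, mul_pow, sq_abs, Pi.sub_apply]
      nlinarith [mul_nonneg (sq_nonneg (T * (f m - f' m))) (sq_nonneg ‖v‖)]

theorem exists_l2norm_le_sqrt_mul_abs {d : ℕ} (hd : 1 ≤ d) (g : Fin d → ℝ) :
    ∃ m, l2norm g ≤ √d * |g m| := by
  have : Nonempty (Fin d) := ⟨⟨0, hd⟩⟩
  obtain ⟨m, hm⟩ := Finite.exists_max fun r => |g r|
  refine ⟨m, Real.sqrt_le_iff.2 ⟨by positivity, ?_⟩⟩
  rw [mul_pow, Real.sq_sqrt (Nat.cast_nonneg d), sq_abs]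
  calc ∑ r, g r ^ 2 ≤ ∑ _r : Fin d, g m ^ 2 := Finset.sum_le_sum fun r _ => sq_le_sq.2 (hm r)
    _ = d * g m ^ 2 := by simp

theorem IsModulatedTone.norm_integral_mul_conj_le {d : ℕ} (hd : 1 ≤ d) {T Δ E E' : ℝ}
    (hT : 0 < T) (hΔ : 0 < Δ) {f f' : Fin d → ℝ} {p q : (Fin d → ℝ) → ℂ}
    (hp : IsModulatedTone T E f p) (hq : IsModulatedTone T E' f' q)
    (hf : Δ ≤ l2norm (f - f')) :
    (T ^ d)⁻¹ * ‖∫ τ in box d T, p τ * (starRingEnd ℂ) (q τ)‖ ≤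
      7 * (√d / (Δ * T)) * (E * E') := by
  obtain ⟨m, hm⟩ := exists_l2norm_le_sqrt_mul_abs hd (f - f')
  obtain ⟨A, B, δ, rfl, hpE, hpB⟩ := hp
  obtain ⟨A', B', δ', rfl, hqE, hqB⟩ := hq
  obtain ⟨n, rfl⟩ : ∃ n, d = n + 1 := Nat.exists_eq_succ_of_ne_zero (by omega)
  have hcH : Continuous fun τ => A + tone B δ τ := continuous_const.add (continuous_tone B δ)
  have hcK : Continuous fun τ => A' + tone B' δ' τ :=
    continuous_const.add (continuous_tone B' δ')
  rw [errT_congr_norm T (b := fun τ => A + tone B δ τ) fun τ => by simp [norm_tone]] at hpE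
  rw [errT_congr_norm T (b := fun τ => A' + tone B' δ' τ) fun τ => by simp [norm_tone]] at hqE
  set g := f - f'
  have hgm : Δ ≤ √(n + 1 : ℕ) * |g m| := hf.trans hm
  have hg : 0 < |g m| := pos_of_mul_pos_right (hΔ.trans_le hgm) (Real.sqrt_nonneg _)
  have hprod (τ : Fin (n + 1) → ℝ) : tone 1 f τ * (A + tone B δ τ) *
      (starRingEnd ℂ) (tone 1 f' τ * (A' + tone B' δ' τ)) =
      tone 1 g τ * ((A + tone B δ τ) * (starRingEnd ℂ) (A' + tone B' δ' τ)) := by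
    rw [map_mul, conj_tone_one, mul_mul_mul_comm, tone_one_mul_tone, ← sub_eq_add_neg]
  simp only [hprod]
  have hmain := norm_integral_tone_mul_le m hT g δ δ' A B A' B' (abs_pos.1 hg)
  have hHK := integral_norm_mul_norm_le hT hcH hcK
  have hH := integral_norm_le_errT hT hcH
  have hK := integral_norm_le_errT hT hcK
  have hE0 : 0 ≤ E := (errT_nonneg _ _).trans hpE
  have hE0' : 0 ≤ E' := (errT_nonneg _ _).trans hqE
  replace hHK := hHK.trans (mul_le_mul hpE hqE (errT_nonneg _ _) hE0)
  replace hH := hH.trans hpE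
  replace hK := hK.trans hqE
  have hbB : |δ m| * ‖B‖ ≤ T⁻¹ * E := by
    rw [inv_mul_eq_div, le_div_iff₀ hT]
    linarith [hpB m]
  have hbB' : |δ' m| * ‖B'‖ ≤ T⁻¹ * E' := by
    rw [inv_mul_eq_div, le_div_iff₀ hT]
    linarith [hqB m]
  rw [integral_const_mul, integral_add (integrable_box (by fun_prop) T)
    (integrable_box (by fun_prop) T), integral_const_mul, integral_const_mul,
    integral_add (integrable_box (by fun_prop) T) (integrable_box (by fun_prop) T),
    integral_const_mul, integral_mul_const] at hmain
  set IHK := ∫ τ in box (n + 1) T, ‖A + tone B δ τ‖ * ‖A' + tone B' δ' τ‖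
  set IH := ∫ τ in box (n + 1) T, ‖A + tone B δ τ‖
  set IK := ∫ τ in box (n + 1) T, ‖A' + tone B' δ' τ‖
  have hIH : 0 ≤ IH := integral_nonneg fun _ => norm_nonneg _
  have hIK : 0 ≤ IK := integral_nonneg fun _ => norm_nonneg _
  have hpi := Real.pi_gt_three
  calc _ ≤ (T ^ (n + 1))⁻¹ * ((2 * π * |g m|)⁻¹ * (2 * T⁻¹ * IHK +
        3 * (2 * π * |δ m| * ‖B‖ * IK + IH * (2 * π * |δ' m| * ‖B'‖)))) :=
        mul_le_mul_of_nonneg_left hmain (by positivity)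
    _ = (2 * π * |g m|)⁻¹ * (2 * T⁻¹ * ((T ^ (n + 1))⁻¹ * IHK) +
        6 * π * ((|δ m| * ‖B‖) * ((T ^ (n + 1))⁻¹ * IK) +
          (|δ' m| * ‖B'‖) * ((T ^ (n + 1))⁻¹ * IH))) := by ring
    _ ≤ (2 * π * |g m|)⁻¹ * (2 * T⁻¹ * (E * E') +
        6 * π * ((T⁻¹ * E) * E' + (T⁻¹ * E') * E)) := by gcongr
    _ = (π⁻¹ + 6) * (E * E') * (|g m| * T)⁻¹ := by
        field_simp
        ring
    _ ≤ 7 * (E * E') * (√(n + 1 : ℕ) / (Δ * T)) := by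
        have h1 : π⁻¹ ≤ 1 := inv_le_one_of_one_le₀ (by linarith)
        have h2 : (|g m| * T)⁻¹ ≤ √(n + 1 : ℕ) / (Δ * T) := by
          rw [inv_eq_one_div, div_le_div_iff₀ (by positivity) (by positivity)]
          nlinarith
        gcongr
        linarith
    _ = _ := by ring

theorem stmt_17 : ∃ C₀ C₁ : ℝ, 0 < C₀ ∧ 0 < C₁ ∧
    ∀ d : ℕ, 1 ≤ d → ∀ T : ℝ, 0 < T →
    ∀ (vi vi' vj vj' : ℂ) (fi fi' fj fj' : Fin d → ℝ) (Δf : ℝ),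
      Δf = min (min (l2norm (fi - fj)) (l2norm (fi - fj')))
               (min (l2norm (fi' - fj)) (l2norm (fi' - fj'))) →
      0 < Δf → l2norm (fi - fi') ≤ Δf → l2norm (fj - fj') ≤ Δf →
      C₀ * d / Δf ≤ T →
      norm (((T ^ d : ℝ) : ℂ)⁻¹ *
          ∫ τ in box d T,
            ((tone vi fi τ - tone vi' fi' τ) *
                (starRingEnd ℂ) (tone vj fj τ - tone vj' fj' τ) +
              (starRingEnd ℂ) (tone vi fi τ - tone vi' fi' τ) *
                (tone vj fj τ - tone vj' fj' τ))) ≤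
        C₁ * (Real.sqrt d / (Δf * T)) *
          errT T (fun τ => tone vi fi τ - tone vi' fi' τ) *
          errT T (fun τ => tone vj fj τ - tone vj' fj' τ) := by
  refine ⟨1, 224, one_pos, by norm_num, ?_⟩
  intro d hd T hT vi vi' vj vj' fi fi' fj fj' Δ hΔ hpos _ _ _
  obtain ⟨⟨h1, h2⟩, h3, h4⟩ : (Δ ≤ l2norm (fi - fj) ∧ Δ ≤ l2norm (fi - fj')) ∧
      Δ ≤ l2norm (fi' - fj) ∧ Δ ≤ l2norm (fi' - fj') := by
    simpa only [le_min_iff] using hΔ.le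
  obtain ⟨p, q, hpq, hp, hq⟩ := exists_isModulatedTone_add hT vi vi' fi fi'
  obtain ⟨r, s, hrs, hr, hs⟩ := exists_isModulatedTone_add hT vj vj' fj fj'
  have b1 := hp.norm_integral_mul_conj_le hd hT hpos hr h1
  have b2 := hp.norm_integral_mul_conj_le hd hT hpos hs h2
  have b3 := hq.norm_integral_mul_conj_le hd hT hpos hr h3
  have b4 := hq.norm_integral_mul_conj_le hd hT hpos hs h4
  set Ei := errT T fun τ => tone vi fi τ - tone vi' fi' τ
  set Ej := errT T fun τ => tone vj fj τ - tone vj' fj' τ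
  simp only [hpq, hrs]
  have cp := hp.continuous
  have cq := hq.continuous
  have cr := hr.continuous
  have cs := hs.continuous
  have hi {F : (Fin d → ℝ) → ℂ} (hF : Continuous F) := integrable_box hF T
  have hz : ∫ τ in box d T, (p τ + q τ) * (starRingEnd ℂ) (r τ + s τ) =
      (∫ τ in box d T, p τ * (starRingEnd ℂ) (r τ)) +
      (∫ τ in box d T, p τ * (starRingEnd ℂ) (s τ)) +
      (∫ τ in box d T, q τ * (starRingEnd ℂ) (r τ)) +
      ∫ τ in box d T, q τ * (starRingEnd ℂ) (s τ) := by
    rw [← integral_add (hi (by fun_prop)) (hi (by fun_prop)),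
      ← integral_add (hi (by fun_prop)) (hi (by fun_prop)),
      ← integral_add (hi (by fun_prop)) (hi (by fun_prop))]
    congr 1 with τ
    rw [map_add]
    ring
  have hconj : ∫ τ in box d T, (starRingEnd ℂ) (p τ + q τ) * (r τ + s τ) =
      (starRingEnd ℂ) (∫ τ in box d T, (p τ + q τ) * (starRingEnd ℂ) (r τ + s τ)) := by
    rw [← integral_conj]
    congr 1 with τ
    rw [map_mul, Complex.conj_conj]
  rw [integral_add (hi (by fun_prop)) (hi (by fun_prop)), hconj, norm_mul, norm_inv,
    Complex.norm_real, Real.norm_of_nonneg (by positivity)]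
  set z := ∫ τ in box d T, (p τ + q τ) * (starRingEnd ℂ) (r τ + s τ)
  have hTd : 0 ≤ (T ^ d)⁻¹ := by positivity
  have hz2 := mul_le_mul_of_nonneg_left
    ((congrArg norm hz).trans_le (norm_add_le_of_le norm_add₃_le le_rfl)) hTd
  have hzz := mul_le_mul_of_nonneg_left (norm_add_le z ((starRingEnd ℂ) z)) hTd
  rw [RCLike.norm_conj] at hzz
  linarith
end

section
/- There exist universal constants c, C > 0 with the following property. Let d ≥ 1, k ≥ 1, η > 0, and let f_1, …, f_k ∈ ℝ^d satisfy ‖f_i − f_j‖₂ ≥ η for all i ≠ j. Fix any point f of the set. Then the points can be reindexed so that f_1 = f and ‖f_1 − f_2‖₂ ≤ ‖f_1 − f_3‖₂ ≤ … ≤ ‖f_1 − f_k‖₂, and for this ordering ‖f_1 − f_j‖₂ ≥ c · (j − 1)^{1/d} · η / √d for every j ∈ {2, …, k}. Moreover, if d ≥ 2 then ∑_{j=2}^{k} 1/‖f_1 − f_j‖₂ ≤ C · k^{1 − 1/d} · √d / η. -/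
open Real

theorem l2norm_eq_norm_toLp {d : ℕ} (x : Fin d → ℝ) : l2norm x = ‖WithLp.toLp 2 x‖ := by
  simp [l2norm, EuclideanSpace.norm_eq]

theorem l2norm_sub_eq_dist_toLp {d : ℕ} (x y : Fin d → ℝ) :
    l2norm (x - y) = dist (WithLp.toLp 2 x) (WithLp.toLp 2 y) := by
  rw [l2norm_eq_norm_toLp, dist_eq_norm, WithLp.toLp_sub]

open MeasureTheory in
/-- Volumetric packing bound: an `η`-separated family inside a ball of radius `R ≥ η` of a
`d`-dimensional Euclidean space has at most `(3 R / η) ^ d` members. -/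
theorem card_mul_pow_le_of_separated {d : ℕ} {ι : Type*} (s : Finset ι)
    (g : ι → EuclideanSpace ℝ (Fin d)) (x : EuclideanSpace ℝ (Fin d)) {η R : ℝ} (hη : 0 < η)
    (hR : η ≤ R) (hsep : ∀ i ∈ s, ∀ j ∈ s, i ≠ j → η ≤ dist (g i) (g j))
    (hball : ∀ i ∈ s, dist x (g i) ≤ R) :
    (s.card : ℝ) * η ^ d ≤ (3 * R) ^ d := by
  have hdisj : Set.PairwiseDisjoint (s : Set ι) fun i => Metric.ball (g i) (η / 2) := by
    intro i hi j hj hij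
    exact Metric.ball_disjoint_ball (by linarith [hsep i hi j hj hij])
  have hsub : (⋃ i ∈ s, Metric.ball (g i) (η / 2)) ⊆ Metric.ball x (3 * R / 2) := by
    intro y hy
    simp only [Set.mem_iUnion, Metric.mem_ball] at hy ⊢
    obtain ⟨i, hi, hy⟩ := hy
    linarith [dist_triangle y (g i) x, hball i hi, dist_comm x (g i)]
  have hvol := measure_mono (μ := volume) hsub
  rw [measure_biUnion_finset hdisj fun _ _ => measurableSet_ball] at hvol
  have hb (y : EuclideanSpace ℝ (Fin d)) (r : ℝ) (hr : 0 < r) :=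
    Measure.addHaar_ball_of_pos (volume : Measure (EuclideanSpace ℝ (Fin d))) y hr
  simp only [hb _ _ (half_pos hη), hb x (3 * R / 2) (by linarith), finrank_euclideanSpace_fin,
    Finset.sum_const, nsmul_eq_mul, ← mul_assoc] at hvol
  rw [ENNReal.mul_le_mul_iff_left (Metric.measure_ball_pos _ _ one_pos).ne'
    measure_ball_lt_top.ne, ← ENNReal.ofReal_natCast,
    ← ENNReal.ofReal_mul (Nat.cast_nonneg _),
    ENNReal.ofReal_le_ofReal_iff (by have := hη.trans_le hR; positivity),
    div_pow, div_pow, ← mul_div_assoc, div_le_div_iff_of_pos_right (by positivity)] at hvol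
  exact hvol

theorem sum_range_add_one_rpow_neg_le {a : ℝ} (ha₀ : 0 ≤ a) (ha : a ≤ 1 / 2) (n : ℕ) :
    ∑ j ∈ Finset.range n, ((j : ℝ) + 1) ^ (-a) ≤ 2 * (n : ℝ) ^ (1 - a) := by
  induction n with
  | zero => simp [Real.zero_rpow (show 1 - a ≠ 0 by linarith)]
  | succ n ih =>
    rw [Finset.sum_range_succ]
    push_cast
    have hn : (0 : ℝ) < n + 1 := by positivity
    have hamgm := Real.geom_mean_le_arith_mean2_weighted (w₁ := 1 - a) (w₂ := a)
      (p₁ := n) (p₂ := n + 1) (by linarith) ha₀ (by positivity) hn.le (by ring)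
    have hpos := Real.rpow_pos_of_pos hn a
    have hstep : ((n : ℝ) + 1) ^ (-a) + 2 * (n : ℝ) ^ (1 - a) ≤ 2 * ((n : ℝ) + 1) ^ (1 - a) := by
      rw [Real.rpow_sub hn, Real.rpow_one, Real.rpow_neg hn.le, ← mul_le_mul_iff_left₀ hpos]
      field_simp
      nlinarith
    linarith

theorem stmt_19 : ∃ c C : ℝ, 0 < c ∧ 0 < C ∧
    ∀ (d k : ℕ), 1 ≤ d → ∀ hk : 0 < k, ∀ η : ℝ, 0 < η →
    ∀ f : Fin k → Fin d → ℝ,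
      (∀ i j, i ≠ j → η ≤ l2norm (f i - f j)) →
      ∀ i₀ : Fin k, ∃ σ : Equiv.Perm (Fin k),
        σ ⟨0, hk⟩ = i₀ ∧
        (∀ p q : Fin k, p ≤ q →
          l2norm (f (σ ⟨0, hk⟩) - f (σ p)) ≤ l2norm (f (σ ⟨0, hk⟩) - f (σ q))) ∧
        (∀ j : Fin k, 1 ≤ (j : ℕ) →
          c * ((j : ℕ) : ℝ) ^ ((1 : ℝ) / d) * η / Real.sqrt d ≤
            l2norm (f (σ ⟨0, hk⟩) - f (σ j))) ∧
        (2 ≤ d →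
          (∑ j ∈ Finset.univ.filter (fun j : Fin k => 1 ≤ (j : ℕ)),
              1 / l2norm (f (σ ⟨0, hk⟩) - f (σ j))) ≤
            C * (k : ℝ) ^ (1 - 1 / (d : ℝ)) * Real.sqrt d / η) := by
  refine ⟨1 / 3, 6, by norm_num, by norm_num, ?_⟩
  intro d k hd hk η hη f hsep i₀
  set σ := Tuple.sort fun i => l2norm (f i₀ - f i)
  have hmono : Monotone ((fun i => l2norm (f i₀ - f i)) ∘ σ) := Tuple.monotone_sort _
  have hσ₀ : σ ⟨0, hk⟩ = i₀ := by
    by_contra hne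
    have hle := hmono (show (⟨0, hk⟩ : Fin k) ≤ σ.symm i₀ from Nat.zero_le _)
    simp only [Function.comp_apply, Equiv.apply_symm_apply] at hle
    have hself : l2norm (f i₀ - f i₀) = 0 := by simp [l2norm]
    linarith [hsep i₀ _ (Ne.symm hne)]
  have hd₀ : (d : ℝ) ≠ 0 := by positivity
  have hsqrt : 1 ≤ √(d : ℝ) := Real.one_le_sqrt.mpr (by exact_mod_cast hd)
  have hdist : ∀ j : Fin k, 1 ≤ (j : ℕ) →
      ((j : ℝ) + 1) ^ ((1 : ℝ) / d) * η / 3 ≤ l2norm (f i₀ - f (σ j)) := by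
    intro j hj
    have hne : i₀ ≠ σ j := by
      rw [← hσ₀]
      intro h
      have := congrArg Fin.val (σ.injective h)
      simp only at this
      omega
    have hR := hsep i₀ (σ j) hne
    have hR₀ := hη.trans_le hR
    have hcard := card_mul_pow_le_of_separated (Finset.Iic j)
      (fun p => WithLp.toLp 2 (f (σ p))) (WithLp.toLp 2 (f i₀)) hη hR
      (fun p _ q _ hpq => by
        rw [← l2norm_sub_eq_dist_toLp]
        exact hsep _ _ (σ.injective.ne hpq))
      (fun p hp => by
        rw [← l2norm_sub_eq_dist_toLp]
        exact hmono (Finset.mem_Iic.mp hp))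
    rw [Fin.card_Iic] at hcard
    push_cast at hcard
    have hpow : (((j : ℝ) + 1) ^ ((1 : ℝ) / d) * η) ^ d ≤
        (3 * l2norm (f i₀ - f (σ j))) ^ d := by
      rwa [mul_pow, ← Real.rpow_natCast, ← Real.rpow_mul (by positivity),
        one_div_mul_cancel hd₀, Real.rpow_one]
    have := le_of_pow_le_pow_left₀ (by omega) (by positivity) hpow
    linarith
  refine ⟨σ, hσ₀, ?_, ?_, ?_⟩
  · intro p q hpq
    rw [hσ₀]
    exact hmono hpq
  · intro j hj
    rw [hσ₀]
    refine le_trans ?_ (hdist j hj)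
    calc 1 / 3 * (j : ℝ) ^ ((1 : ℝ) / d) * η / √d ≤ 1 / 3 * (j : ℝ) ^ ((1 : ℝ) / d) * η :=
          div_le_self (by positivity) hsqrt
      _ ≤ 1 / 3 * ((j : ℝ) + 1) ^ ((1 : ℝ) / d) * η := by
          gcongr
          linarith
      _ = ((j : ℝ) + 1) ^ ((1 : ℝ) / d) * η / 3 := by ring
  · intro hd₂
    rw [hσ₀]
    have ha : 1 / (d : ℝ) ≤ 1 / 2 :=
      one_div_le_one_div_of_le two_pos (by exact_mod_cast hd₂)
    calc ∑ j ∈ Finset.univ.filter (fun j : Fin k => 1 ≤ (j : ℕ)), 1 / l2norm (f i₀ - f (σ j))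
        ≤ ∑ j ∈ Finset.univ.filter (fun j : Fin k => 1 ≤ (j : ℕ)),
            3 / η * ((j : ℝ) + 1) ^ (-(1 / (d : ℝ))) := by
          refine Finset.sum_le_sum fun j hj => ?_
          refine (one_div_le_one_div_of_le (by positivity)
            (hdist j (Finset.mem_filter.mp hj).2)).trans_eq ?_
          rw [Real.rpow_neg (by positivity)]
          field_simp
      _ ≤ ∑ j : Fin k, 3 / η * ((j : ℝ) + 1) ^ (-(1 / (d : ℝ))) :=
          Finset.sum_le_sum_of_subset_of_nonneg (Finset.filter_subset _ _)
            fun _ _ _ => by positivity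
      _ = 3 / η * ∑ j ∈ Finset.range k, ((j : ℝ) + 1) ^ (-(1 / (d : ℝ))) := by
          rw [← Finset.mul_sum,
            Fin.sum_univ_eq_sum_range fun j : ℕ => ((j : ℝ) + 1) ^ (-(1 / (d : ℝ)))]
      _ ≤ 3 / η * (2 * (k : ℝ) ^ (1 - 1 / (d : ℝ))) := by
          gcongr
          exact sum_range_add_one_rpow_neg_le (by positivity) ha k
      _ = 6 * (k : ℝ) ^ (1 - 1 / (d : ℝ)) * 1 / η := by ring
      _ ≤ 6 * (k : ℝ) ^ (1 - 1 / (d : ℝ)) * √d / η := by gcongr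
end
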